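/- Let n ≥ 1, let D^{2n} ⊂ T^{2n} be an embedded codimension-zero disc in the standard 2n-torus, and let θ : T^{2n} → S^{2n} be the map obtained by collapsing the complement of the interior of D^{2n} to a point (θ restricts to the identity on the interior of the disc). Then the induced map of homotopy class sets θ̂ : [S^{2n}, SO(2n)/U(n)] → [T^{2n}, SO(2n)/U(n)], [ψ] ↦ [ψ ∘ θ], is injective. -/

import Mathlib

set_option linter.unusedSectionVars false

noncomputable section

open scoped Topology

/-- The standard `m`-torus, as a topological space. -/
abbrev Torus (m : ℕ) : Type := Fin m → AddCircle (1 : ℝ)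

/-- `SO(m)`: the subgroup of the (real) orthogonal group consisting of matrices of
determinant `1`. -/
def SOgrp (m : ℕ) : Subgroup (Matrix.unitaryGroup (Fin m) ℝ) where
  carrier := {A | (A : Matrix (Fin m) (Fin m) ℝ).det = 1}
  one_mem' := by simp
  mul_mem' := by
    intro a b ha hb
    show ((a * b : Matrix.unitaryGroup (Fin m) ℝ) : Matrix (Fin m) (Fin m) ℝ).det = 1
    rw [Matrix.UnitaryGroup.mul_val, Matrix.det_mul, ha, hb, mul_one]
  inv_mem' := by
    intro a ha
    show ((a⁻¹ : Matrix.unitaryGroup (Fin m) ℝ) : Matrix (Fin m) (Fin m) ℝ).det = 1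
    rw [Matrix.UnitaryGroup.inv_val, Matrix.star_eq_conjTranspose,
      Matrix.det_conjTranspose, ha, star_one]

/-- The matrix of the standard complex structure on `ℝ^{2n} ≅ ℂ^n`:
`J e_i = e_{i+n}`, `J e_{i+n} = -e_i` for `i < n`. -/
def Jmat (n : ℕ) : Matrix (Fin (2 * n)) (Fin (2 * n)) ℝ :=
  Matrix.of fun i j =>
    if i.val = j.val + n then 1 else if j.val = i.val + n then -1 else 0

/-- `U(n) ⊂ SO(2n)`: the subgroup of special orthogonal matrices commuting with the
standard complex structure `J`, i.e. the image of the standard embedding `U(n) ↪ SO(2n)`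
under the identification `ℂ^n ≅ ℝ^{2n}`.  (The set of such matrices is already a subgroup;
taking `Subgroup.closure` merely packages it as a `Subgroup`.) -/
def Usub (n : ℕ) : Subgroup (SOgrp (2 * n)) :=
  Subgroup.closure
    {A : SOgrp (2 * n) |
      ((A : Matrix.unitaryGroup (Fin (2 * n)) ℝ) : Matrix (Fin (2 * n)) (Fin (2 * n)) ℝ)
          * Jmat n
        = Jmat n *
          ((A : Matrix.unitaryGroup (Fin (2 * n)) ℝ) : Matrix (Fin (2 * n)) (Fin (2 * n)) ℝ)}

/-- The homogeneous space `SO(2n)/U(n)` with the quotient topology. -/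
abbrev SOmodU (n : ℕ) : Type := SOgrp (2 * n) ⧸ Usub n


namespace CubeLem
open unitInterval ContinuousMap

variable {ι : Type} [Fintype ι] [DecidableEq ι] {X : Type} [TopologicalSpace X]

/-- clamp to the unit interval -/
def pj (r : ℝ) : I := Set.projIcc 0 1 zero_le_one r

@[fun_prop] lemma continuous_pj : Continuous pj := continuous_projIcc (h := zero_le_one)

lemma pj_zero {r : ℝ} (h : r ≤ 0) : pj r = 0 := Set.projIcc_of_le_left _ h
lemma pj_one {r : ℝ} (h : 1 ≤ r) : pj r = 1 := Set.projIcc_of_right_le _ h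
lemma pj_coe (u : I) : pj (u : ℝ) = u := Set.projIcc_val _ u

/-- squeeze family -/
def cc (s : I) (u : I) : I := pj ((1 + 2 * (s : ℝ)) * u - s)
/-- push family -/
def dd (s : I) (u : I) : I := pj ((1 + 2 * (s : ℝ)) * u - 2 * s)
/-- tent -/
def tt (u : I) : ℝ := min (3 * (u : ℝ)) (3 - 3 * u)

@[fun_prop] lemma continuous_cc {Z : Type*} [TopologicalSpace Z] {a b : Z → I} (ha : Continuous a)
    (hb : Continuous b) : Continuous fun z => cc (a z) (b z) := by
  unfold cc; fun_prop
@[fun_prop] lemma continuous_dd {Z : Type*} [TopologicalSpace Z] {a b : Z → I} (ha : Continuous a)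
    (hb : Continuous b) : Continuous fun z => dd (a z) (b z) := by
  unfold dd; fun_prop
@[fun_prop] lemma continuous_tt : Continuous tt := by
  unfold tt; fun_prop

@[simp] lemma cc_zero (u : I) : cc 0 u = u := by simp [cc, pj_coe]
@[simp] lemma dd_zero (u : I) : dd 0 u = u := by simp [dd, pj_coe]
@[simp] lemma cc_at_zero (s : I) : cc s 0 = 0 := by
  apply pj_zero; have := s.2.1; simp; exact this
@[simp] lemma cc_at_one (s : I) : cc s 1 = 1 := by
  apply pj_one; have := s.2.1; simp; linarith
@[simp] lemma dd_at_zero (s : I) : dd s 0 = 0 := by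
  apply pj_zero; have := s.2.1; simp; exact this
@[simp] lemma dd_at_one (s : I) : dd s 1 = 1 := by
  apply pj_one; have := s.2.1; simp
@[simp] lemma tt_zero : tt 0 = 0 := by simp [tt]
@[simp] lemma tt_one : tt 1 = 0 := by simp [tt]

lemma cc_low {u : I} (h : (u : ℝ) ≤ 1/3) : cc 1 u = 0 := by
  apply pj_zero; simp; linarith
lemma cc_high {u : I} (h : 2/3 ≤ (u : ℝ)) : cc 1 u = 1 := by
  apply pj_one; simp; linarith
lemma dd_low {u : I} (h : (u : ℝ) ≤ 2/3) : dd 1 u = 0 := by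
  apply pj_zero; simp; linarith
lemma tt_mid {u : I} (h : 1/3 ≤ (u : ℝ)) (h' : (u : ℝ) ≤ 2/3) : 1 ≤ tt u := by
  apply le_min <;> linarith

/-- endpoint -/
def Ep (u : I) : Prop := u = 0 ∨ u = 1

lemma Ep.cc {u : I} (h : Ep u) (s : I) : Ep (cc s u) := by
  rcases h with rfl | rfl <;> simp [Ep]
lemma Ep.dd {u : I} (h : Ep u) (s : I) : Ep (dd s u) := by
  rcases h with rfl | rfl <;> simp [Ep]
lemma Ep.tt {u : I} (h : Ep u) : tt u = 0 := by
  rcases h with rfl | rfl <;> simp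
lemma ep_cc_of {u : I} (h : 1/6 ≤ |(u : ℝ) - 1/2|) : Ep (CubeLem.cc 1 u) := by
  rcases le_abs.1 h with h | h
  · right; apply cc_high; linarith
  · left; apply cc_low; linarith
lemma Ep.abs {u : I} (h : Ep u) : |(u : ℝ) - 1/2| = 1/2 := by
  rcases h with rfl | rfl <;> norm_num [abs_of_nonneg, abs_of_neg]

/-- boundary constancy -/
def BC (x : X) (f : (ι → I) → X) : Prop := ∀ z, (∃ i, Ep (z i)) → f z = x

/-- K-periodic, collapsed at the others, based -/
structure PK (K : Finset ι) (x : X) (f : (ι → I) → X) : Prop where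
  per : ∀ z z', (∀ i, z i = z' i ∨ (i ∈ K ∧ Ep (z i) ∧ Ep (z' i))) → f z = f z'
  col : ∀ z, (∃ i, i ∉ K ∧ Ep (z i)) → f z = x
  bas : f (fun _ => 0) = x

lemma BC.PK [Nonempty ι] {x : X} {f : (ι → I) → X} (h : BC x f) (K : Finset ι) : PK K x f where
  per z z' hz := by
    by_cases e : z = z'
    · rw [e]
    · obtain ⟨i, hi⟩ := Function.ne_iff.1 e
      rcases hz i with h1 | h1
      · exact absurd h1 hi
      · rw [h z ⟨i, h1.2.1⟩, h z' ⟨i, h1.2.2⟩]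
  col z hz := h z (hz.imp fun i hi => hi.2)
  bas := h _ ⟨Classical.arbitrary ι, Or.inl rfl⟩

/-- relation -/
def Rl (P : ((ι → I) → X) → Prop) (f g : C(ι → I, X)) : Prop :=
  HomotopicWith f g (fun h => P h)

lemma mkR {P : ((ι → I) → X) → Prop} {f g : C(ι → I, X)} (F : I × (ι → I) → X) (hF : Continuous F)
    (h0 : ∀ z, F (0, z) = f z) (h1 : ∀ z, F (1, z) = g z) (hP : ∀ s, P fun z => F (s, z)) :
    Rl P f g :=
  ⟨{ toFun := F, continuous_toFun := hF, map_zero_left := h0, map_one_left := h1, prop' := hP }⟩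

lemma Rl.trans {P : ((ι → I) → X) → Prop} {f g h : C(ι → I, X)} (a : Rl P f g) (b : Rl P g h) :
    Rl P f h := HomotopicWith.trans a b
lemma Rl.symm {P : ((ι → I) → X) → Prop} {f g : C(ι → I, X)} (a : Rl P f g) :
    Rl P g f := HomotopicWith.symm a
lemma Rl.mono {P Q : ((ι → I) → X) → Prop} {f g : C(ι → I, X)} (a : Rl P f g)
    (h : ∀ f, P f → Q f) : Rl Q f g := by
  obtain ⟨H⟩ := a
  exact ⟨{ H.toHomotopy with prop' := fun t => h _ (H.prop' t) }⟩

lemma Rl.get {P : ((ι → I) → X) → Prop} {f g : C(ι → I, X)} (a : Rl P f g) :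
    ∃ H : I × (ι → I) → X, Continuous H ∧ (∀ z, H (0, z) = f z) ∧ (∀ z, H (1, z) = g z) ∧
      ∀ s, P fun z => H (s, z) := by
  obtain ⟨H⟩ := a
  exact ⟨H.toFun, H.continuous_toFun, H.map_zero_left, H.map_one_left, H.prop'⟩

/-- squeeze -/
def sq (f : C(ι → I, X)) : C(ι → I, X) := ⟨fun z => f (fun i => cc 1 (z i)), by fun_prop⟩

lemma rl_sq {x : X} (f : C(ι → I, X)) (hf : BC x f) : Rl (BC x) f (sq f) := by
  refine mkR (fun p => f (fun i => cc p.1 (p.2 i))) (by fun_prop) (by simp) (by simp [sq]) ?_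
  rintro s z ⟨i, hi⟩
  exact hf _ ⟨i, hi.cc s⟩

/-- centre -/
def ctr : ι → I := fun _ => ⟨1/2, by norm_num, by norm_num⟩

lemma dist_ctr (z : ι → I) (i : ι) : dist (z i) (ctr i) = |(z i : ℝ) - 1/2| := rfl

lemma ep_far {z : ι → I} {i : ι} (h : Ep (z i)) : ¬ dist z ctr ≤ 1/6 := by
  intro h'
  have := (dist_le_pi_dist z ctr i).trans h'
  rw [dist_ctr, h.abs] at this
  norm_num at this

lemma near {z : ι → I} (h : dist z ctr ≤ 1/6) (i : ι) : 1/3 ≤ (z i : ℝ) ∧ (z i : ℝ) ≤ 2/3 := by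
  have := (dist_le_pi_dist z ctr i).trans h
  rw [dist_ctr, abs_le] at this
  constructor <;> linarith [this.1, this.2]

lemma far {z : ι → I} (h : 1/6 ≤ dist z ctr) : ∃ i, Ep (cc 1 (z i)) := by
  by_contra hc
  push Not at hc
  have : dist z ctr < 1/6 := by
    rw [dist_pi_lt_iff (by norm_num)]
    intro i
    rw [dist_ctr]
    by_contra h2
    exact hc i (ep_cc_of (not_lt.1 h2))
  linarith

lemma mid_iff {u : I} : |(u:ℝ) - 1/2| ≤ 1/6 ↔ 1/3 ≤ (u:ℝ) ∧ (u:ℝ) ≤ 2/3 := by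
  rw [abs_le]; constructor <;> rintro ⟨a, b⟩ <;> constructor <;> linarith

lemma step [Nonempty ι] {x : X} {K : Finset ι} {k : ι} (hk : k ∈ K) {f g : C(ι → I, X)}
    (hf : BC x f) (hg : BC x g) (h : Rl (PK K x) f g) : Rl (PK (K.erase k) x) f g := by
  obtain ⟨H, hH, H0, H1, HP⟩ := h.get
  have Hcol := fun s => (HP s).col
  have Hper := fun s => (HP s).per
  have Hbas := fun s => (HP s).bas
  have Hend : ∀ z, (∃ i, Ep (z i)) → H (1, z) = x := fun z hz => by rw [H1, hg z hz]
  have Hstart : ∀ z, (∃ i, Ep (z i)) → H (0, z) = x := fun z hz => by rw [H0, hf z hz]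
  -- first homotopy
  let A : I × (ι → I) → X := fun p =>
    H (pj (p.1 * tt (p.2 k)), fun i => if i = k then cc p.1 (p.2 i) else p.2 i)
  have hA : Continuous A := by
    refine hH.comp (Continuous.prodMk (by fun_prop) (continuous_pi fun i => ?_))
    by_cases hi : i = k
    · simp only [hi, if_true]; fun_prop
    · simp only [hi, if_false]; fun_prop
  let J : I × (ι → I) → X := fun p =>
    if |(p.2 k : ℝ) - 1/2| ≤ 1/6 then g (fun i => if i = k then cc 1 (p.2 i) else cc p.1 (p.2 i))
      else H (pj (tt (p.2 k)), fun i => if i = k then 0 else dd p.1 (p.2 i))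
  have hJ : Continuous J := by
    refine Continuous.if_le ?_ ?_ (by fun_prop) (by fun_prop) ?_
    · refine g.continuous.comp (continuous_pi fun i => ?_)
      by_cases hi : i = k
      · simp only [hi, if_true]; fun_prop
      · simp only [hi, if_false]; fun_prop
    · refine hH.comp (Continuous.prodMk (by fun_prop) (continuous_pi fun i => ?_))
      by_cases hi : i = k
      · simp only [hi, if_true]; fun_prop
      · simp only [hi, if_false]; fun_prop
    · intro p hp
      have hm := mid_iff.1 hp.le
      rw [hg _ ⟨k, by simpa using ep_cc_of hp.ge⟩, pj_one (tt_mid hm.1 hm.2),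
        Hend _ ⟨k, by simp [Ep]⟩]
  let M : I × (ι → I) → X := fun p =>
    if dist p.2 ctr ≤ 1/6 then g (fun i => cc 1 (p.2 i))
      else H (pj ((1 - p.1) * tt (p.2 k)), fun i => if i = k then 0 else dd 1 (p.2 i))
  have hM : Continuous M := by
    refine Continuous.if_le ?_ ?_ (by fun_prop) (by fun_prop) ?_
    · fun_prop
    · refine hH.comp (Continuous.prodMk (by fun_prop) (continuous_pi fun i => ?_))
      by_cases hi : i = k
      · simp only [hi, if_true]; fun_prop
      · simp only [hi, if_false]; fun_prop
    · intro p hp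
      rw [hg _ (far hp.ge)]
      have : (fun i => if i = k then 0 else dd 1 (p.2 i)) = fun _ => (0 : I) := by
        funext i
        split_ifs
        · rfl
        · exact dd_low (near hp.le i).2
      rw [this, Hbas]
  have PA : ∀ s, PK (K.erase k) x fun z => A (s, z) := by
    intro s
    have col : ∀ z : ι → I, (∃ i, i ∉ K.erase k ∧ Ep (z i)) → A (s, z) = x := by
      rintro z ⟨i, hi, hz⟩
      by_cases hik : i = k
      · subst hik
        simp only [A, hz.tt, mul_zero, pj_zero le_rfl]
        exact Hstart _ ⟨i, by simpa using hz.cc s⟩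
      · exact Hcol _ _ ⟨i, fun h => hi (Finset.mem_erase.2 ⟨hik, h⟩), by simpa [hik] using hz⟩
    refine ⟨?_, col, col _ ⟨k, by simp, by simp [Ep]⟩⟩
    intro z z' hz
    have hzk : z k = z' k := (hz k).resolve_right (by simp)
    simp only [A, hzk]
    apply Hper
    intro i
    by_cases hik : i = k
    · subst hik; left; simp [hzk]
    · simp only [hik, if_false]
      exact (hz i).imp id fun h => ⟨Finset.mem_of_mem_erase h.1, h.2⟩
  have PJ : ∀ s, PK (K.erase k) x fun z => J (s, z) := by
    intro s
    have col : ∀ z : ι → I, (∃ i, i ∉ K.erase k ∧ Ep (z i)) → J (s, z) = x := by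
      rintro z ⟨i, hi, hz⟩
      by_cases hik : i = k
      · subst hik
        simp only [J, hz.tt, pj_zero le_rfl, hz.abs]
        rw [if_neg (by norm_num)]
        exact Hstart _ ⟨i, by simp [Ep]⟩
      · simp only [J]
        split_ifs
        · exact hg _ ⟨i, by simpa [hik] using hz.cc s⟩
        · exact Hcol _ _ ⟨i, fun h => hi (Finset.mem_erase.2 ⟨hik, h⟩),
            by simpa [hik] using hz.dd s⟩
    refine ⟨?_, col, col _ ⟨k, by simp, by simp [Ep]⟩⟩
    intro z z' hz
    have hzk : z k = z' k := (hz k).resolve_right (by simp)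
    simp only [J, hzk]
    split_ifs
    · apply (hg.PK K).per
      intro i
      by_cases hik : i = k
      · subst hik; left; simp [hzk]
      · simp only [hik, if_false]
        exact (hz i).imp (fun h => by rw [h]) fun h =>
          ⟨Finset.mem_of_mem_erase h.1, h.2.1.cc s, h.2.2.cc s⟩
    · apply Hper
      intro i
      by_cases hik : i = k
      · subst hik; left; simp
      · simp only [hik, if_false]
        exact (hz i).imp (fun h => by rw [h]) fun h =>
          ⟨Finset.mem_of_mem_erase h.1, h.2.1.dd s, h.2.2.dd s⟩
  have PM : ∀ s, PK (K.erase k) x fun z => M (s, z) := by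
    intro s
    have col : ∀ z : ι → I, (∃ i, i ∉ K.erase k ∧ Ep (z i)) → M (s, z) = x := by
      rintro z ⟨i, hi, hz⟩
      simp only [M]
      rw [if_neg (ep_far hz)]
      by_cases hik : i = k
      · subst hik
        rw [hz.tt, mul_zero, pj_zero le_rfl]
        exact Hstart _ ⟨i, by simp [Ep]⟩
      · exact Hcol _ _ ⟨i, fun h => hi (Finset.mem_erase.2 ⟨hik, h⟩),
            by simpa [hik] using hz.dd 1⟩
    refine ⟨?_, col, col _ ⟨k, by simp, by simp [Ep]⟩⟩
    intro z z' hz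
    by_cases e : z = z'
    · rw [e]
    obtain ⟨j, hj⟩ := Function.ne_iff.1 e
    have hj' := (hz j).resolve_left hj
    have hzk : z k = z' k := (hz k).resolve_right (by simp)
    simp only [M, hzk]
    rw [if_neg (ep_far hj'.2.1), if_neg (ep_far hj'.2.2)]
    apply Hper
    intro i
    by_cases hik : i = k
    · subst hik; left; simp
    · simp only [hik, if_false]
      exact (hz i).imp (fun h => by rw [h]) fun h =>
          ⟨Finset.mem_of_mem_erase h.1, h.2.1.dd 1, h.2.2.dd 1⟩
  have RA : Rl (PK (K.erase k) x) f ⟨fun z => A (1, z), by fun_prop⟩ := by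
    refine mkR A hA ?_ (fun z => rfl) PA
    intro z
    simp [A, pj_zero, H0]
  have RJ : Rl (PK (K.erase k) x) ⟨fun z => A (1, z), by fun_prop⟩
      ⟨fun z => J (1, z), by fun_prop⟩ := by
    refine mkR J hJ ?_ (fun z => rfl) PJ
    intro z
    simp only [J, A, ContinuousMap.coe_mk]
    split_ifs with hc
    · have hm := mid_iff.1 hc
      rw [Set.Icc.coe_one, one_mul, pj_one (tt_mid hm.1 hm.2), H1]
      simp
    · simp only [Set.Icc.coe_one, one_mul]
      apply Hper
      intro i
      by_cases hik : i = k
      · subst hik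
        right
        simp only [if_true]
        exact ⟨hk, by simp [Ep], ep_cc_of (not_le.1 hc).le⟩
      · left; simp [hik]
  have RM : Rl (PK (K.erase k) x) ⟨fun z => J (1, z), by fun_prop⟩ (sq g) := by
    refine mkR M hM ?_ ?_ PM
    · intro z
      simp only [M, J, ContinuousMap.coe_mk]
      split_ifs with h1 h2 h2
      · simp
      · exact absurd (mid_iff.2 (near h1 k)) h2
      · have hm := mid_iff.1 h2
        simp only [Set.Icc.coe_zero, sub_zero, one_mul]
        rw [pj_one (tt_mid hm.1 hm.2), Hend _ ⟨k, by simp [Ep]⟩]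
        simp only [ite_self]
        rw [hg _ (far (not_le.1 h1).le)]
      · simp
    · intro z
      simp only [M, sq, ContinuousMap.coe_mk]
      split_ifs with h1
      · rfl
      · rw [hg _ (far (not_le.1 h1).le)]
        simp only [Set.Icc.coe_one, sub_self, zero_mul, pj_zero le_rfl]
        exact Hstart _ ⟨k, by simp [Ep]⟩
  exact RA.trans (RJ.trans (RM.trans ((rl_sq g hg).mono fun f hf => hf.PK _).symm))

lemma steps [Nonempty ι] {x : X} {f g : C(ι → I, X)}
    (hf : BC x f) (hg : BC x g) (K : Finset ι) (h : Rl (PK K x) f g) : Rl (BC x) f g := by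
  induction K using Finset.induction_on with
  | empty => exact h.mono fun f hf z hz => hf.col z (by simpa using hz)
  | insert k K hk ih =>
    apply ih
    have := step (Finset.mem_insert_self k K) hf hg h
    rwa [Finset.erase_insert hk] at this

/-- periodic -/
def Per (f : (ι → I) → X) : Prop := ∀ z z', (∀ i, z i = z' i ∨ (Ep (z i) ∧ Ep (z' i))) → f z = f z'

/-- folded coordinates -/
def fo (z : ι → I) : ι → ℝ := fun i => min (z i : ℝ) (1 - z i)

lemma cube_main [Nonempty ι] {x y : X} {f g : C(ι → I, X)}
    (hf : BC x f) (hg : BC y g) (h : Rl Per f g) : Rl (fun f => ∃ x, BC x f) f g := by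
  obtain ⟨H, hH, H0, H1, Hper⟩ := h.get
  have i0 : ι := Classical.arbitrary ι
  have Hend : ∀ z, (∃ i, Ep (z i)) → H (1, z) = y := fun z hz => by rw [H1, hg z hz]
  have Hstart : ∀ z, (∃ i, Ep (z i)) → H (0, z) = x := fun z hz => by rw [H0, hf z hz]
  have hfo : Continuous (fo : (ι → I) → ι → ℝ) := by unfold fo; fun_prop
  have ez : ∀ z : ι → I, (∃ i, Ep (z i)) → dist z ctr = 1/2 := by
    rintro z ⟨i, hi⟩
    apply le_antisymm
    · rw [dist_pi_le_iff (by norm_num)]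
      intro j
      rw [dist_ctr, abs_le]
      have h1 := (z j).2.1
      have h2 := (z j).2.2
      constructor <;> linarith
    · rw [← hi.abs, ← dist_ctr]; exact dist_le_pi_dist z ctr i
  have fo_ep : ∀ z z' : ι → I, (∀ i, z i = z' i ∨ (Ep (z i) ∧ Ep (z' i))) → fo z = fo z' := by
    intro z z' hz
    funext i
    simp only [fo]
    rcases hz i with h | ⟨h | h, h' | h'⟩ <;> simp [*]
  let B : I × (ι → I) → X := fun p =>
    H (pj (p.1 * (3 * ‖fo p.2‖)), fun i => cc 1 (p.2 i))
  have hB : Continuous B := by fun_prop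
  let G : I × (ι → I) → X := fun p =>
    if dist p.2 ctr ≤ 1/6 then g (fun i => cc 1 (p.2 i))
      else H (pj ((1 - p.1) * (3 * ‖fo p.2‖) + p.1 * (3 * (1/2 - dist p.2 ctr))), fun _ => 0)
  have hG : Continuous G := by
    refine Continuous.if_le (by fun_prop) (by fun_prop) (by fun_prop) (by fun_prop) ?_
    intro p hp
    have h1 : 1 ≤ 3 * ‖fo p.2‖ := by
      have := norm_le_pi_norm (fo p.2) i0
      have h2 := near hp.le i0
      have : 1/3 ≤ fo p.2 i0 := le_min h2.1 (by linarith)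
      linarith [le_abs_self (fo p.2 i0), Real.norm_eq_abs (fo p.2 i0)]
    have h0 := p.1.2.2
    rw [pj_one, Hend _ ⟨i0, Or.inl rfl⟩, hg _ (far hp.ge)]
    rw [hp]
    nlinarith
  let L : I × (ι → I) → X := fun p =>
    if dist p.2 ctr ≤ 1/6 then g (fun i => cc 1 (p.2 i))
      else H (pj (p.1 + (1 - p.1) * (3 * (1/2 - dist p.2 ctr))), fun _ => 0)
  have hL : Continuous L := by
    refine Continuous.if_le (by fun_prop) (by fun_prop) (by fun_prop) (by fun_prop) ?_
    intro p hp
    rw [pj_one, Hend _ ⟨i0, Or.inl rfl⟩, hg _ (far hp.ge)]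
    rw [hp]
    linarith
  let g' : C(ι → I, X) := ⟨fun z => G (1, z), by fun_prop⟩
  have hg' : BC x g' := by
    rintro z ⟨i, hi⟩
    simp only [g', G, ContinuousMap.coe_mk]
    rw [if_neg (ep_far hi), ez z ⟨i, hi⟩, pj_zero (by simp)]
    exact Hstart _ ⟨i0, Or.inl rfl⟩
  have fo0 : fo (fun _ : ι => (0 : I)) = 0 := by funext i; simp [fo]
  have RB : Rl (PK Finset.univ x) (sq f) ⟨fun z => B (1, z), by fun_prop⟩ := by
    refine mkR B hB ?_ (fun z => rfl) ?_
    · intro z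
      simp only [B, sq, Set.Icc.coe_zero, zero_mul, pj_zero le_rfl, ContinuousMap.coe_mk, H0]
    · intro s
      refine ⟨?_, by simp, ?_⟩
      · intro z z' hz
        have hz' : ∀ i, z i = z' i ∨ (Ep (z i) ∧ Ep (z' i)) := by simpa using hz
        simp only [B, fo_ep z z' hz']
        apply Hper
        intro i
        exact (hz' i).imp (fun h => by rw [h]) fun h => ⟨h.1.cc 1, h.2.cc 1⟩
      · simp only [B, fo0, norm_zero, mul_zero, pj_zero le_rfl]
        exact Hstart _ ⟨i0, by simp [Ep]⟩
  have RG : Rl (PK Finset.univ x) ⟨fun z => B (1, z), by fun_prop⟩ g' := by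
    refine mkR G hG ?_ (fun z => rfl) ?_
    · intro z
      simp only [G, B, ContinuousMap.coe_mk, Set.Icc.coe_zero, Set.Icc.coe_one, sub_zero, one_mul,
        zero_mul, add_zero]
      split_ifs with hc
      · have h1 : 1 ≤ 3 * ‖fo z‖ := by
          have := norm_le_pi_norm (fo z) i0
          have h2 := near hc i0
          have : 1/3 ≤ fo z i0 := le_min h2.1 (by linarith)
          linarith [le_abs_self (fo z i0), Real.norm_eq_abs (fo z i0)]
        rw [pj_one h1, H1]
      · by_cases h1 : 1 ≤ 3 * ‖fo z‖
        · rw [pj_one h1, Hend _ ⟨i0, Or.inl rfl⟩, Hend _ (far (not_le.1 hc).le)]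
        · apply Hper
          intro i
          right
          refine ⟨Or.inl rfl, ep_cc_of ?_⟩
          have h2 := norm_le_pi_norm (fo z) i
          have h3 : fo z i < 1/3 := by
            linarith [le_abs_self (fo z i), Real.norm_eq_abs (fo z i)]
          rw [le_abs]
          rcases min_lt_iff.1 h3 with h | h
          · right; linarith
          · left; linarith
    · intro s
      refine ⟨?_, by simp, ?_⟩
      · intro z z' hz
        have hz' : ∀ i, z i = z' i ∨ (Ep (z i) ∧ Ep (z' i)) := by simpa using hz
        by_cases e : z = z'
        · rw [e]
        obtain ⟨j, hj⟩ := Function.ne_iff.1 e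
        have hj' := (hz' j).resolve_left hj
        simp only [G, fo_ep z z' hz']
        rw [if_neg (ep_far hj'.1), if_neg (ep_far hj'.2), ez z ⟨j, hj'.1⟩, ez z' ⟨j, hj'.2⟩]
      · have e0 : Ep ((fun _ : ι => (0 : I)) i0) := Or.inl rfl
        simp only [G]
        rw [if_neg (ep_far (z := fun _ => 0) (i := i0) e0), ez (fun _ => 0) ⟨i0, e0⟩, fo0, norm_zero, pj_zero (by simp)]
        exact Hstart _ ⟨i0, e0⟩
  have RL : Rl (fun f => ∃ x, BC x f) g' (sq g) := by
    refine mkR L hL ?_ ?_ ?_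
    · intro z
      simp [L, g', G]
    · intro z
      simp only [L, sq, ContinuousMap.coe_mk]
      split_ifs with hc
      · rfl
      · rw [pj_one (by simp), Hend _ ⟨i0, Or.inl rfl⟩, hg _ (far (not_le.1 hc).le)]
    · intro s
      refine ⟨H (s, fun _ => 0), ?_⟩
      rintro z ⟨i, hi⟩
      show L (s, z) = _
      simp only [L]
      rw [if_neg (ep_far hi), ez z ⟨i, hi⟩]
      simp [pj_coe]
  have R1 : Rl (PK Finset.univ x) f g' :=
    ((rl_sq f hf).mono fun f hf => hf.PK _).trans (RB.trans RG)
  have R2 := (steps hf hg' _ R1).mono (Q := fun f => ∃ x, BC x f) fun f hf => ⟨x, hf⟩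
  exact R2.trans (RL.trans ((rl_sq g hg).mono fun f hf => ⟨y, hf⟩).symm)

end CubeLem

namespace Coll
open unitInterval ContinuousMap Topology OnePoint

open Classical in
/-- Pontryagin collapse of an open embedding -/
def coll {A B : Type} (h : A → B) (b : B) : OnePoint A :=
  if hb : ∃ a, h a = b then ((hb.choose : A) : OnePoint A) else ∞

lemma coll_apply {A B : Type} {h : A → B} (hi : Function.Injective h) (a : A) :
    coll h (h a) = (a : OnePoint A) := by
  have hb : ∃ a', h a' = h a := ⟨a, rfl⟩
  rw [coll, dif_pos hb, hi hb.choose_spec]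

lemma coll_not {A B : Type} {h : A → B} {b : B} (hb : ¬ ∃ a, h a = b) :
    coll h b = ∞ := by
  rw [coll, dif_neg hb]

lemma coll_comp {A B Z : Type} {h : A → B} (hi : Function.Injective h) {g : Z → A}
    (gi : Function.Injective g) (b : B) :
    coll (fun z => (g z : OnePoint A)) (coll h b) = coll (fun z => h (g z)) b := by
  have gi' : Function.Injective (fun z => (g z : OnePoint A)) :=
    (OnePoint.coe_injective).comp gi
  by_cases hb : ∃ a, h a = b
  · obtain ⟨a, rfl⟩ := hb
    rw [coll_apply hi]
    by_cases ha : ∃ z, g z = a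
    · obtain ⟨z, rfl⟩ := ha
      rw [coll_apply (h := fun z => (g z : OnePoint A)) gi' z,
        coll_apply (h := fun z => h (g z)) (hi.comp gi) z]
    · rw [coll_not, coll_not]
      · rintro ⟨z, hz⟩; exact ha ⟨z, hi hz⟩
      · rintro ⟨z, hz⟩; exact ha ⟨z, OnePoint.coe_injective hz⟩
  · rw [coll_not hb, coll_not, coll_not]
    · rintro ⟨z, hz⟩; exact hb ⟨_, hz⟩
    · rintro ⟨z, hz⟩; exact OnePoint.coe_ne_infty _ hz

lemma continuous_coll {A B : Type} [TopologicalSpace A] [TopologicalSpace B] [T2Space B]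
    {h : A → B} (hh : IsOpenEmbedding h) : Continuous (coll h) := by
  have key : ∀ s : Set (OnePoint A), ∞ ∉ s → coll h ⁻¹' s = h '' ((↑) ⁻¹' s) := by
    intro s hs
    ext b
    constructor
    · intro hb
      by_cases hc : ∃ a, h a = b
      · obtain ⟨a, rfl⟩ := hc
        refine ⟨a, ?_, rfl⟩
        simpa [coll_apply hh.injective] using hb
      · rw [Set.mem_preimage, coll_not hc] at hb
        exact absurd hb hs
    · rintro ⟨a, ha, rfl⟩
      simpa [coll_apply hh.injective] using ha
  rw [continuous_def]
  intro s hs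
  by_cases hi : ∞ ∈ s
  · rw [isOpen_iff_of_mem hi] at hs
    have : coll h ⁻¹' s = (h '' ((↑) ⁻¹' sᶜ))ᶜ := by
      rw [← key sᶜ (by simpa using hi)]; simp
    rw [this, isOpen_compl_iff]
    have hc : IsCompact ((↑) ⁻¹' sᶜ : Set A) := by simpa using hs.2
    exact (hc.image hh.continuous).isClosed
  · rw [key s hi]
    exact hh.isOpenMap _ ((isOpen_iff_of_notMem hi).1 hs)

variable {m : ℕ}

/-- model space -/
abbrev E (m : ℕ) : Type := Fin m → ℝ

lemma shrink_fam (v : E m) {ε : ℝ} (hε : 0 < ε) :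
    IsOpenEmbedding (fun p : I × E m =>
      (p.1, (p.1 : ℝ) • v + (1 + (p.1 / ε) * ‖p.2‖)⁻¹ • p.2)) := by
  have pos : ∀ p : I × E m, 0 < 1 + (p.1 / ε) * ‖p.2‖ := by
    intro p
    have := p.1.2.1
    positivity
  let e : OpenPartialHomeomorph (I × E m) (I × E m) :=
    { toFun := fun p => (p.1, (p.1 : ℝ) • v + (1 + (p.1 / ε) * ‖p.2‖)⁻¹ • p.2)
      invFun := fun p => (p.1, (1 - (p.1 / ε) * ‖p.2 - (p.1 : ℝ) • v‖)⁻¹ • (p.2 - (p.1 : ℝ) • v))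
      source := Set.univ
      target := {p | (p.1 / ε) * ‖p.2 - (p.1 : ℝ) • v‖ < 1}
      map_source' := by
        intro p _
        have h := pos p
        simp only [Set.mem_ofPred_eq, add_sub_cancel_left, norm_smul, norm_inv, Real.norm_eq_abs,
          abs_of_pos h]
        rw [← mul_assoc, mul_comm _ (_⁻¹), mul_assoc, inv_mul_lt_iff₀ h]
        linarith
      map_target' := fun _ _ => Set.mem_univ _
      left_inv' := by
        intro p _
        have h := pos p
        refine Prod.ext rfl ?_
        simp only [add_sub_cancel_left, norm_smul, norm_inv, Real.norm_eq_abs,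
          abs_of_pos h, smul_smul]
        rw [← mul_inv]
        have : (1 - (p.1 : ℝ) / ε * ((1 + p.1 / ε * ‖p.2‖)⁻¹ * ‖p.2‖)) * (1 + p.1 / ε * ‖p.2‖) = 1 := by
          have := h.ne'
          set c := (p.1 : ℝ) / ε
          rw [sub_mul, mul_assoc, mul_assoc, mul_comm ‖p.2‖ (1 + _), inv_mul_cancel_left₀ this]
          ring
        rw [this]; simp
      right_inv' := by
        intro p hp
        have h : 0 < 1 - (p.1 / ε) * ‖p.2 - (p.1 : ℝ) • v‖ := by
          have : (p.1 / ε) * ‖p.2 - (p.1 : ℝ) • v‖ < 1 := hp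
          linarith
        refine Prod.ext rfl ?_
        simp only [norm_smul, norm_inv, Real.norm_eq_abs, abs_of_pos h, smul_smul]
        rw [← mul_inv]
        set N := ‖p.2 - (p.1 : ℝ) • v‖
        have : (1 + (p.1 : ℝ) / ε * ((1 - p.1 / ε * N)⁻¹ * N)) * (1 - p.1 / ε * N) = 1 := by
          have := h.ne'
          rw [add_mul, mul_assoc, mul_assoc, mul_comm N, inv_mul_cancel_left₀ this]
          ring
        rw [this]; simp
      open_source := isOpen_univ
      open_target := isOpen_lt (by fun_prop) (by fun_prop)
      continuousOn_toFun := by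
        apply Continuous.continuousOn
        refine continuous_fst.prodMk (Continuous.add (by fun_prop) (Continuous.fun_smul ?_ continuous_snd))
        exact Continuous.fun_inv₀ (by fun_prop) fun p => (pos p).ne'
      continuousOn_invFun := by
        refine continuousOn_fst.prodMk (ContinuousOn.fun_smul ?_
          (Continuous.continuousOn (continuous_snd.fun_sub ((by fun_prop : Continuous fun p : I × E m => (p.1 : ℝ) • v)))))
        refine ContinuousOn.fun_inv₀ (by fun_prop) fun p hp => ?_
        have : (p.1 / ε) * ‖p.2 - (p.1 : ℝ) • v‖ < 1 := hp
        linarith }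
  exact e.isOpenEmbedding rfl

lemma shrink (v : E m) {ε : ℝ} (hε : 0 < ε) :
    ∃ κ : E m → E m, IsOpenEmbedding κ ∧ (∀ w, κ w ∈ Metric.ball v ε) ∧
      ∀ f : C(OnePoint (E m), OnePoint (E m)), (∀ u, f u = coll (fun w => (κ w : OnePoint (E m))) u) →
        f.Homotopic (ContinuousMap.id _) := by
  have hR0 := shrink_fam v hε
  set R0 := (fun p : I × E m => (p.1, (p.1 : ℝ) • v + (1 + (p.1 / ε) * ‖p.2‖)⁻¹ • p.2)) with hR0def
  let R : I × E m → I × OnePoint (E m) := fun p => ((R0 p).1, ((R0 p).2 : OnePoint (E m)))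
  have hR : IsOpenEmbedding R :=
    (IsOpenEmbedding.prodMap IsOpenEmbedding.id (OnePoint.isOpenEmbedding_coe (X := E m))).comp hR0
  let κ : E m → E m := fun w => (R0 (1, w)).2
  have κi : Function.Injective κ := by
    intro w w' h
    have : ((1 : I), w) = (1, w') := hR0.injective (Prod.ext rfl h)
    exact (Prod.ext_iff.1 this).2
  have κc : Continuous κ := continuous_snd.comp (hR0.continuous.comp (by fun_prop))
  have κo : IsOpenMap κ := by
    intro s hs
    have : κ '' s = (fun u => ((1 : I), u)) ⁻¹' (R0 '' (Set.univ ×ˢ s)) := by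
      ext u
      constructor
      · rintro ⟨w, hw, rfl⟩
        exact ⟨(1, w), ⟨trivial, hw⟩, rfl⟩
      · rintro ⟨⟨t, w⟩, ⟨-, hw⟩, h⟩
        have h1 : t = 1 := (Prod.ext_iff.1 h).1
        subst h1
        exact ⟨w, hw, (Prod.ext_iff.1 h).2⟩
    rw [this]
    exact (hR0.isOpenMap _ (isOpen_univ.prod hs)).preimage (by fun_prop)
  have hκ : IsOpenEmbedding κ := .of_continuous_injective_isOpenMap κc κi κo
  refine ⟨κ, hκ, ?_, ?_⟩
  · intro w
    have h : 0 < 1 + (1 / ε) * ‖w‖ := by positivity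
    have : κ w - v = (1 + (1 / ε) * ‖w‖)⁻¹ • w := by simp [κ, hR0def]
    rw [mem_ball_iff_norm, this, norm_smul, norm_inv, Real.norm_eq_abs, abs_of_pos h,
      inv_mul_lt_iff₀ h]
    field_simp
    linarith
  · intro f hf
    have hcm : Continuous (OnePoint.map (Prod.snd : I × E m → E m)) := by
      refine OnePoint.continuous_map continuous_snd ?_
      rw [Filter.coclosedCompact_eq_cocompact, Filter.coclosedCompact_eq_cocompact]
      exact (isProperMap_iff_tendsto_cocompact.1 isProperMap_snd_of_compactSpace).2
    let F : I × OnePoint (E m) → OnePoint (E m) := fun p =>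
      OnePoint.map (Prod.snd : I × E m → E m) (coll R p)
    have hF : Continuous F := hcm.comp (continuous_coll hR)
    have F0 : ∀ u, F (0, u) = u := by
      intro u
      induction u using OnePoint.rec with
      | infty =>
        simp only [F]
        rw [coll_not]
        · rfl
        · rintro ⟨p, hp⟩
          exact OnePoint.coe_ne_infty _ (Prod.ext_iff.1 hp).2
      | coe w =>
        have : ((0 : I), (w : OnePoint (E m))) = R (0, w) := by simp [R, hR0def]
        simp only [F]
        rw [this, coll_apply hR.injective]; rfl
    have F1 : ∀ u, F (1, u) = f u := by
      intro u
      rw [hf]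
      simp only [F]
      by_cases hu : ∃ w, (κ w : OnePoint (E m)) = u
      · obtain ⟨w, rfl⟩ := hu
        rw [coll_apply (h := fun w => (κ w : OnePoint (E m))) (OnePoint.coe_injective.comp κi) w]
        have : ((1 : I), (κ w : OnePoint (E m))) = R (1, w) := rfl
        rw [this, coll_apply hR.injective]; rfl
      · rw [coll_not hu, coll_not]
        · rfl
        · rintro ⟨⟨t, w⟩, hp⟩
          have h1 : t = 1 := (Prod.ext_iff.1 hp).1
          subst h1
          exact hu ⟨w, (Prod.ext_iff.1 hp).2⟩
    refine ContinuousMap.Homotopic.symm ⟨?_⟩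
    exact { toFun := F, continuous_toFun := hF, map_zero_left := F0, map_one_left := F1 }

/-- torus -/
abbrev T (m : ℕ) : Type := Fin m → AddCircle (1 : ℝ)

/-- the big cell -/
def be (w : E m) : T m := fun i => ((Real.sigmoid (w i) : ℝ) : AddCircle (1 : ℝ))

lemma sig_open : IsOpenEmbedding Real.sigmoid := by
  refine ⟨Real.sigmoid_strictMono.isEmbedding_of_ordConnected ?_, ?_⟩
  · rw [Real.range_sigmoid]; exact Set.ordConnected_Ioo
  · rw [Real.range_sigmoid]; exact isOpen_Ioo

lemma coe_inj {x y : ℝ} (hx : x ∈ Set.Ico (0:ℝ) 1) (hy : y ∈ Set.Ico (0:ℝ) 1)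
    (h : (x : AddCircle (1:ℝ)) = y) : x = y := by
  have : Fact ((0:ℝ) < 1) := ⟨one_pos⟩
  exact (AddCircle.coe_eq_coe_iff_of_mem_Ico (a := 0) (by simpa using hx) (by simpa using hy)).1 h

lemma sig_mem (x : ℝ) : Real.sigmoid x ∈ Set.Ico (0:ℝ) 1 :=
  ⟨Real.sigmoid_nonneg x, Real.sigmoid_lt_one x⟩

lemma be_open : IsOpenEmbedding (be : E m → T m) := by
  refine .of_continuous_injective_isOpenMap ?_ ?_ ?_
  · exact continuous_pi fun i => (AddCircle.continuous_mk' 1).comp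
      (sig_open.continuous.comp (continuous_apply i))
  · intro w w' h
    funext i
    exact Real.sigmoid_injective (coe_inj (sig_mem _) (sig_mem _) (congrFun h i))
  · have : IsOpenMap (Pi.map (fun (_ : Fin m) (x : ℝ) => ((Real.sigmoid x : ℝ) : AddCircle (1 : ℝ)))) := by
      refine IsOpenMap.piMap (fun i => ?_) (by simp [Filter.cofinite_eq_bot])
      exact QuotientAddGroup.isOpenMap_coe.comp sig_open.isOpenMap
    exact this

/-- cube to torus -/
def cub (z : Fin m → I) : T m := fun i => ((z i : ℝ) : AddCircle (1 : ℝ))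

lemma continuous_cub : Continuous (cub : (Fin m → I) → T m) :=
  continuous_pi fun i => (AddCircle.continuous_mk' 1).comp
      (continuous_subtype_val.comp (continuous_apply i))

lemma cub_ep {u : I} (h : CubeLem.Ep u) : ((u : ℝ) : AddCircle (1:ℝ)) = 0 := by
  rcases h with rfl | rfl
  · simp
  · simp

lemma not_ep {u : I} (h : ¬ CubeLem.Ep u) : ∃ w, Real.sigmoid w = u := by
  have : (u : ℝ) ∈ Set.range Real.sigmoid := by
    rw [Real.range_sigmoid]
    exact ⟨lt_of_le_of_ne u.2.1 fun e => h (Or.inl (Subtype.ext e.symm)),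
      lt_of_le_of_ne u.2.2 fun e => h (Or.inr (Subtype.ext e))⟩
  exact this

lemma bd_coll {z : Fin m → I} (h : ∃ i, CubeLem.Ep (z i)) : coll be (cub z) = ∞ := by
  apply coll_not
  rintro ⟨w, hw⟩
  obtain ⟨i, hi⟩ := h
  have h1 : ((Real.sigmoid (w i) : ℝ) : AddCircle (1:ℝ)) = ((0:ℝ) : AddCircle (1:ℝ)) := by
    have := congrFun hw i
    simp only [be, cub, cub_ep hi] at this
    simpa using this
  have := coe_inj (sig_mem _) (by simp) h1
  exact (Real.sigmoid_pos _).ne' this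

lemma int_coll {z : Fin m → I} (h : ¬ ∃ i, CubeLem.Ep (z i)) :
    ∃ w : E m, (∀ i, Real.sigmoid (w i) = z i) ∧ coll be (cub z) = (w : OnePoint (E m)) := by
  push Not at h
  choose w hw using fun i => not_ep (h i)
  refine ⟨w, hw, ?_⟩
  have : cub z = be w := by funext i; simp [cub, be, hw]
  rw [this, coll_apply be_open.injective]

lemma q_surj [Nonempty (Fin m)] (u : OnePoint (E m)) : ∃ z : Fin m → I, coll be (cub z) = u := by
  induction u using OnePoint.rec with
  | infty => exact ⟨fun _ => 0, bd_coll ⟨Classical.arbitrary _, Or.inl rfl⟩⟩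
  | coe w =>
    refine ⟨fun i => ⟨Real.sigmoid (w i), Real.sigmoid_nonneg _, Real.sigmoid_le_one _⟩, ?_⟩
    exact coll_apply be_open.injective w

variable {X : Type} [TopologicalSpace X]

/-- the collapse of the big cell, bundled -/
def bec : C(T m, OnePoint (E m)) := ⟨coll be, continuous_coll be_open⟩

lemma std [Nonempty (Fin m)] (ψ₁ ψ₂ : C(OnePoint (E m), X))
    (h : (ψ₁.comp bec).Homotopic (ψ₂.comp bec)) : ψ₁.Homotopic ψ₂ := by
  let q : C(Fin m → I, OnePoint (E m)) := bec.comp ⟨cub, continuous_cub⟩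
  have hq : ∀ z, q z = coll be (cub z) := fun z => rfl
  have hbc : ∀ ψ : C(OnePoint (E m), X), CubeLem.BC (ψ ∞) (ψ.comp q) := by
    intro ψ z hz
    simp [hq, bd_coll hz]
  have hper : CubeLem.Rl CubeLem.Per (ψ₁.comp q) (ψ₂.comp q) := by
    obtain ⟨H⟩ := h
    refine CubeLem.mkR (fun p => H (p.1, cub p.2)) ?_ ?_ ?_ ?_
    · exact H.continuous.comp (continuous_fst.prodMk (continuous_cub.comp continuous_snd))
    · intro z; simp [q]
    · intro z; simp [q]
    · intro s z z' hz
      have : cub z = cub z' := by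
        funext i
        rcases hz i with h | ⟨h, h'⟩
        · simp [cub, h]
        · simp [cub, cub_ep h, cub_ep h']
      simp [this]
  obtain ⟨H, hH, H0, H1, HP⟩ := (CubeLem.cube_main (hbc ψ₁) (hbc ψ₂) hper).get
  let Q : C(I × (Fin m → I), I × OnePoint (E m)) := ⟨fun p => (p.1, q p.2), by fun_prop⟩
  have hQ : IsQuotientMap Q := by
    refine (Q.continuous.isClosedMap).isQuotientMap Q.continuous ?_
    rintro ⟨t, u⟩
    obtain ⟨z, hz⟩ := q_surj u
    exact ⟨(t, z), Prod.ext rfl hz⟩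
  have hfac : ∀ p p', Q p = Q p' → H p = H p' := by
    rintro ⟨t, z⟩ ⟨t', z'⟩ h
    have ht : t = t' := (Prod.ext_iff.1 h).1
    have hz : coll be (cub z) = coll be (cub z') := (Prod.ext_iff.1 h).2
    subst ht
    obtain ⟨x, hx⟩ := HP t
    by_cases h1 : ∃ i, CubeLem.Ep (z i) <;> by_cases h2 : ∃ i, CubeLem.Ep (z' i)
    · exact (hx z h1).trans (hx z' h2).symm
    · obtain ⟨w, -, hw⟩ := int_coll h2
      rw [bd_coll h1, hw] at hz
      exact absurd hz.symm (OnePoint.coe_ne_infty _)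
    · obtain ⟨w, -, hw⟩ := int_coll h1
      rw [bd_coll h2, hw] at hz
      exact absurd hz (OnePoint.coe_ne_infty _)
    · obtain ⟨w, hw1, hw⟩ := int_coll h1
      obtain ⟨w', hw1', hw'⟩ := int_coll h2
      rw [hw, hw'] at hz
      have e : w = w' := OnePoint.coe_injective hz
      have : z = z' := by
        funext i
        apply Subtype.ext
        rw [← hw1, ← hw1', e]
      rw [this]
  let Lf : C(I × OnePoint (E m), X) := hQ.lift ⟨H, hH⟩ (fun p p' h => hfac p p' h)
  have hLf : ∀ p, Lf (Q p) = H p := fun p => DFunLike.congr_fun (hQ.lift_comp ⟨H, hH⟩ (fun p p' h => hfac p p' h)) p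
  refine ⟨{ toFun := Lf, continuous_toFun := Lf.continuous, map_zero_left := ?_, map_one_left := ?_ }⟩
  · intro u
    obtain ⟨z, rfl⟩ := q_surj u
    exact (hLf (0, z)).trans (H0 z)
  · intro u
    obtain ⟨z, rfl⟩ := q_surj u
    exact (hLf (1, z)).trans (H1 z)

lemma gen [Nonempty (Fin m)] (θ : C(T m, OnePoint (E m))) (U : Set (T m)) (hU : IsOpen U)
    (hne : U.Nonempty) (hinj : Set.InjOn θ U) (hsat : ∀ x ∈ U, ∀ y, θ y = θ x → y ∈ U)
    (hquot : IsQuotientMap θ) (ψ₁ ψ₂ : C(OnePoint (E m), X))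
    (h : (ψ₁.comp θ).Homotopic (ψ₂.comp θ)) : ψ₁.Homotopic ψ₂ := by
  obtain ⟨x0, hx0⟩ := hne
  let a : T m := x0 - be 0
  let ba : E m → T m := fun w => be w + a
  have hba : IsOpenEmbedding ba := (Homeomorph.addRight a).isOpenEmbedding.comp be_open
  have hb0 : ba 0 = x0 := by simp [ba, a]
  obtain ⟨ε, hε, hεU⟩ : ∃ ε > 0, Metric.ball (0 : E m) ε ⊆ ba ⁻¹' U :=
    Metric.isOpen_iff.1 (hU.preimage hba.continuous) 0 (by simpa [hb0] using hx0)
  obtain ⟨κ, hκ, hκb, hκh⟩ := shrink (0 : E m) hε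
  let ρ : E m → T m := fun w => ba (κ w)
  have hρ : IsOpenEmbedding ρ := hba.comp hκ
  have hρU : ∀ w, ρ w ∈ U := fun w => hεU (hκb w)
  let r : E m → OnePoint (E m) := fun w => θ (ρ w)
  have ri : Function.Injective r := fun w w' e => hρ.injective (hinj (hρU w) (hρU w') e)
  have hr : IsOpenEmbedding r := by
    refine .of_continuous_injective_isOpenMap (θ.continuous.comp hρ.continuous) ri ?_
    intro s hs
    have : r '' s = θ '' (ρ '' s) := by rw [Set.image_image]
    rw [this, ← hquot.isOpen_preimage]
    have : θ ⁻¹' (θ '' (ρ '' s)) = ρ '' s := by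
      apply Set.Subset.antisymm _ (Set.subset_preimage_image _ _)
      rintro y ⟨_, ⟨w, hw, rfl⟩, e⟩
      have hy := hsat _ (hρU w) y e.symm
      rw [← hinj (hρU w) hy e]
      exact ⟨w, hw, rfl⟩
    rw [this]
    exact hρ.isOpenMap s hs
  let A : C(OnePoint (E m), OnePoint (E m)) := ⟨coll r, continuous_coll hr⟩
  let cκ : C(OnePoint (E m), OnePoint (E m)) := ⟨coll (fun w => (κ w : OnePoint (E m))),
    continuous_coll (OnePoint.isOpenEmbedding_coe.comp hκ)⟩
  let cb : C(T m, OnePoint (E m)) := ⟨coll ba, continuous_coll hba⟩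
  have hAθ : A.comp θ = cκ.comp cb := by
    ext x
    show coll r (θ x) = coll (fun w => (κ w : OnePoint (E m))) (coll ba x)
    rw [coll_comp hba.injective hκ.injective]
    by_cases hx : ∃ w, ρ w = x
    · obtain ⟨w, rfl⟩ := hx
      exact (coll_apply ri w).trans (coll_apply hρ.injective w).symm
    · rw [coll_not hx, coll_not]
      rintro ⟨w, hw⟩
      exact hx ⟨w, hinj (hρU w) (hsat _ (hρU w) x hw.symm) hw⟩
  have hcκ : cκ.Homotopic (ContinuousMap.id _) := hκh cκ fun u => rfl
  -- a left homotopy inverse of A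
  obtain ⟨B, hB⟩ : ∃ B : C(OnePoint (E m), OnePoint (E m)),
      (B.comp A).Homotopic (ContinuousMap.id _) := by
    obtain ⟨v, hv⟩ : ∃ v : E m, (v : OnePoint (E m)) ∈ Set.range r := by
      have hne : r 0 ≠ r 1 := fun e => by
        have := congrFun (ri e) (Classical.arbitrary (Fin m))
        simp at this
      by_cases h0 : r 0 = ∞
      · obtain ⟨v, hv⟩ := OnePoint.ne_infty_iff_exists.1 (fun e => hne (h0.trans e.symm))
        exact ⟨v, 1, hv.symm⟩
      · obtain ⟨v, hv⟩ := OnePoint.ne_infty_iff_exists.1 h0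
        exact ⟨v, 0, hv.symm⟩
    obtain ⟨δ, hδ, hδU⟩ : ∃ δ > 0, Metric.ball v δ ⊆ (fun v : E m => (v : OnePoint (E m))) ⁻¹' (Set.range r) :=
      Metric.isOpen_iff.1 (hr.isOpen_range.preimage OnePoint.continuous_coe) v hv
    obtain ⟨κ', hκ', hκb', hκh'⟩ := shrink v hδ
    choose k hk using fun w => hδU (hκb' w)
    have hk' : r ∘ k = fun w => (κ' w : OnePoint (E m)) := funext hk
    have hko : IsOpenEmbedding k := by
      apply IsOpenEmbedding.of_comp k hr
      rw [hk']
      exact OnePoint.isOpenEmbedding_coe.comp hκ'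
    refine ⟨⟨coll (fun w => (k w : OnePoint (E m))),
      continuous_coll (OnePoint.isOpenEmbedding_coe.comp hko)⟩, hκh' _ fun u => ?_⟩
    rw [← hk']
    exact coll_comp ri hko.injective u
  have key : ∀ ψ : C(OnePoint (E m), X), (((ψ.comp B).comp cb)).Homotopic (ψ.comp θ) := by
    intro ψ
    have e1 : ((ψ.comp B).comp (cκ.comp cb)).Homotopic (ψ.comp θ) := by
      rw [← hAθ]
      have := ((Homotopic.refl ψ).comp hB).comp (Homotopic.refl θ)
      simpa [ContinuousMap.comp_assoc] using this
    have e2 : ((ψ.comp B).comp (cκ.comp cb)).Homotopic ((ψ.comp B).comp cb) := by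
      have := (Homotopic.refl (ψ.comp B)).comp (hcκ.comp (Homotopic.refl cb))
      simpa using this
    exact e2.symm.trans e1
  have h2 : ((ψ₁.comp B).comp cb).Homotopic ((ψ₂.comp B).comp cb) :=
    ((key ψ₁).trans h).trans (key ψ₂).symm
  have h3 : ((ψ₁.comp B).comp bec).Homotopic ((ψ₂.comp B).comp bec) := by
    let tr : C(T m, T m) := ⟨fun x => x + a, by fun_prop⟩
    have hcb : cb.comp tr = bec := by
      ext x
      show coll ba (x + a) = coll be x
      by_cases hx : ∃ w, be w = x
      · obtain ⟨w, rfl⟩ := hx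
        exact (coll_apply hba.injective w).trans (coll_apply be_open.injective w).symm
      · rw [coll_not hx, coll_not]
        rintro ⟨w, hw⟩
        exact hx ⟨w, add_right_cancel hw⟩
    have := h2.comp (Homotopic.refl tr)
    rwa [ContinuousMap.comp_assoc, ContinuousMap.comp_assoc _ cb, hcb] at this
  have h4 := std _ _ h3
  have h5 : ∀ ψ : C(OnePoint (E m), X), ((ψ.comp B).comp A).Homotopic ψ := by
    intro ψ
    have := (Homotopic.refl ψ).comp hB
    simpa [ContinuousMap.comp_assoc] using this
  exact ((h5 ψ₁).symm.trans (h4.comp (Homotopic.refl A))).trans (h5 ψ₂)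

end Coll

/-- **Lemma 2** (Hajduk–Tralle).  Let `D^{2n}` be an embedded codimension-zero disc in the
torus `T^{2n}` (the image of a topological embedding of the closed unit ball), and let
`θ : T^{2n} → S^{2n}` be the map collapsing the complement of the interior of the disc to
a point `p` (so `θ` is a homeomorphism from the interior of the disc onto `S^{2n} ∖ {p}`
and is a quotient map).  Then `θ̂ : [S^{2n}, SO(2n)/U(n)] → [T^{2n}, SO(2n)/U(n)]`,
`[ψ] ↦ [ψ ∘ θ]`, is injective: maps `ψ₁, ψ₂ : S^{2n} → SO(2n)/U(n)` with `ψ₁ ∘ θ ≃ ψ₂ ∘ θ`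
are homotopic. -/
theorem collapse_induced_map_injective (n : ℕ) (hn : 1 ≤ n)
    (e : Metric.closedBall (0 : EuclideanSpace ℝ (Fin (2 * n))) 1 → Torus (2 * n))
    (he : Topology.IsEmbedding e)
    (D : Set (Torus (2 * n))) (hD : D = Set.range e)
    (θ : C(Torus (2 * n), Metric.sphere (0 : EuclideanSpace ℝ (Fin (2 * n + 1))) 1))
    (p : Metric.sphere (0 : EuclideanSpace ℝ (Fin (2 * n + 1))) 1)
    (hcollapse : ∀ x ∉ interior D, θ x = p)
    (hinj : Set.InjOn θ (interior D))
    (himg : θ '' interior D = {p}ᶜ)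
    (hquot : Topology.IsQuotientMap θ)
    (ψ₁ ψ₂ : C(Metric.sphere (0 : EuclideanSpace ℝ (Fin (2 * n + 1))) 1, SOmodU n))
    (hhom : (ψ₁.comp θ).Homotopic (ψ₂.comp θ)) :
    ψ₁.Homotopic ψ₂ := by
  have hne : Nonempty (Fin (2 * n)) := ⟨⟨0, by omega⟩⟩
  let Φ : OnePoint (Coll.E (2 * n)) ≃ₜ Metric.sphere (0 : EuclideanSpace ℝ (Fin (2 * n + 1))) 1 :=
    onePointEquivSphereOfFinrankEq (by simp)
  let Φc : C(OnePoint (Coll.E (2 * n)), Metric.sphere (0 : EuclideanSpace ℝ (Fin (2 * n + 1))) 1) :=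
    ⟨Φ, Φ.continuous⟩
  let Φi : C(Metric.sphere (0 : EuclideanSpace ℝ (Fin (2 * n + 1))) 1, OnePoint (Coll.E (2 * n))) :=
    ⟨Φ.symm, Φ.symm.continuous⟩
  have hci : Φc.comp Φi = ContinuousMap.id _ := by ext1 x; exact Φ.apply_symm_apply x
  have hne' : (interior D).Nonempty := by
    obtain ⟨u, hu⟩ := exists_ne (Φ.symm p)
    have : Φ u ∈ θ '' interior D := by
      rw [himg]
      intro h
      apply hu
      rw [← h, Φ.symm_apply_apply]
    obtain ⟨x, hx, -⟩ := this
    exact ⟨x, hx⟩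
  have hcc : ∀ ψ : C(Metric.sphere (0 : EuclideanSpace ℝ (Fin (2 * n + 1))) 1, SOmodU n),
      (ψ.comp Φc).comp Φi = ψ := by
    intro ψ
    rw [ContinuousMap.comp_assoc, hci, ContinuousMap.comp_id]
  have main := Coll.gen (Φi.comp θ) (interior D) isOpen_interior hne'
    (fun x hx y hy e => hinj hx hy (Φ.symm.injective e))
    (fun x hx y e => by
      by_contra hy
      have e' : θ y = θ x := Φ.symm.injective e
      have hxp : θ x ∈ ({p}ᶜ : Set _) := himg ▸ Set.mem_image_of_mem θ hx
      exact hxp (e' ▸ hcollapse y hy))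
    (Φ.symm.isQuotientMap.comp hquot) (ψ₁.comp Φc) (ψ₂.comp Φc)
    (by rw [← ContinuousMap.comp_assoc, ← ContinuousMap.comp_assoc, hcc, hcc]; exact hhom)
  have := main.comp (ContinuousMap.Homotopic.refl Φi)
  rwa [hcc, hcc] at this
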